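/- Let G be a bridgeless simple graph and H a bridgeless subgraph of G such that every vertex of G is at distance at most 2 from V(H) in G. If H has a strong orientation of diameter d, then G has a strong orientation of diameter at most d + 12 that extends the given orientation of H. -/

import Mathlib

open SimpleGraph

/-- `D` is an orientation of the simple graph `G`: every arc of `D` lies along an edge of `G`,
and every edge of `G` receives exactly one of the two possible directions. -/
def IsOrientation {V : Type*} (G : SimpleGraph V) (D : V → V → Prop) : Prop :=
  (∀ u v, D u v → G.Adj u v) ∧ ∀ u v, G.Adj u v → (D u v ↔ ¬ D v u)

/-- There is a directed walk of length `n` from `u` to `v` in the digraph with arc relation `D`. -/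
def DiReach {V : Type*} (D : V → V → Prop) (u v : V) (n : ℕ) : Prop :=
  ∃ f : Fin (n + 1) → V, f 0 = u ∧ f (Fin.last n) = v ∧
    ∀ i : Fin n, D (f i.castSucc) (f i.succ)

/-- A graph is bridgeless if it is connected and none of its edges is a bridge. -/
def Bridgeless {V : Type*} (G : SimpleGraph V) : Prop :=
  G.Connected ∧ ∀ e : Sym2 V, ¬ G.IsBridge e

/-- `hPoly δ g = 1 + δ + ∑_{i=1}^{⌊(g-1)/2⌋ - 1} δ (δ - 3)^i`. -/
def hPoly (δ g : ℕ) : ℕ :=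
  1 + δ + ∑ i ∈ Finset.Icc 1 ((g - 1) / 2 - 1), δ * (δ - 3) ^ i

namespace DiReach

variable {V : Type*} {D D' : V → V → Prop} {u v w : V} {m n : ℕ}

theorem refl (D : V → V → Prop) (u : V) : DiReach D u u 0 :=
  ⟨fun _ => u, rfl, rfl, fun i => i.elim0⟩

theorem snoc (h : DiReach D u v n) (hvw : D v w) : DiReach D u w (n + 1) := by
  obtain ⟨f, h0, hl, hf⟩ := h
  refine ⟨Fin.snoc f w, ?_, by simp, fun i => ?_⟩
  · rw [← Fin.castSucc_zero, Fin.snoc_castSucc, h0]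
  · induction i using Fin.lastCases with
    | last => simpa [hl] using hvw
    | cast i => simpa only [← Fin.castSucc_succ, Fin.snoc_castSucc] using hf i

theorem eq_of_zero (h : DiReach D u v 0) : u = v := by
  obtain ⟨f, h0, hl, -⟩ := h
  exact h0.symm.trans hl

theorem exists_last (h : DiReach D u v (n + 1)) : ∃ w, DiReach D u w n ∧ D w v := by
  obtain ⟨f, h0, hl, hf⟩ := h
  refine ⟨f (Fin.last n).castSucc, ⟨fun i => f i.castSucc, h0, rfl, fun i => hf i.castSucc⟩, ?_⟩
  rw [← hl]
  exact hf (Fin.last n)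

theorem single (h : D u v) : DiReach D u v 1 :=
  (refl D u).snoc h

theorem trans (h : DiReach D u v m) (h' : DiReach D v w n) : DiReach D u w (m + n) := by
  induction n generalizing w with
  | zero => exact h'.eq_of_zero ▸ h
  | succ n ih =>
    obtain ⟨x, hx, hxw⟩ := h'.exists_last
    exact (ih hx).snoc hxw

theorem map {W : Type*} {E : W → W → Prop} (f : V → W) (hf : ∀ x y, D x y → E (f x) (f y))
    (h : DiReach D u v n) : DiReach E (f u) (f v) n := by
  obtain ⟨g, h0, hl, hg⟩ := h
  exact ⟨f ∘ g, congrArg f h0, congrArg f hl, fun i => hf _ _ (hg i)⟩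

theorem mono (hD : ∀ x y, D x y → D' x y) (h : DiReach D u v n) : DiReach D' u v n :=
  h.map id hD

theorem flip (h : DiReach D u v n) : DiReach (flip D) v u n := by
  induction n generalizing v with
  | zero => exact h.eq_of_zero ▸ refl _ _
  | succ n ih =>
    obtain ⟨x, hx, hxv⟩ := h.exists_last
    rw [Nat.add_comm]
    exact (single (D := _root_.flip D) hxv).trans (ih hx)

theorem symm (hD : ∀ x y, D x y → D y x) (h : DiReach D u v n) : DiReach D v u n :=
  h.flip.mono fun x y hxy => hD y x hxy

theorem of_walk {G : SimpleGraph V} (p : G.Walk u v) : DiReach G.Adj u v p.length := by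
  induction p with
  | nil => exact refl _ _
  | cons h p ih =>
    rw [Walk.length_cons, Nat.add_comm]
    exact (single h).trans ih

/-- A sequence that follows arcs from index `i` to index `j` is a directed walk. -/
theorem of_seq {g : ℕ → V} {i j : ℕ} (hij : i ≤ j)
    (hg : ∀ k, i ≤ k → k < j → D (g k) (g (k + 1))) : DiReach D (g i) (g j) (j - i) := by
  induction j, hij using Nat.le_induction with
  | base => simpa using refl D (g i)
  | succ j hij ih =>
    rw [Nat.succ_sub hij]
    exact (ih fun k hk hkj => hg k hk (by omega)).snoc (hg j hij (by omega))

theorem exists_seq (h : DiReach D u v n) :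
    ∃ g : ℕ → V, g 0 = u ∧ g n = v ∧ ∀ k < n, D (g k) (g (k + 1)) := by
  obtain ⟨f, h0, hl, hf⟩ := h
  refine ⟨fun k => f (Fin.ofNat (n + 1) k), ?_, ?_, fun k hk => ?_⟩
  · rw [← h0]
    rfl
  · rw [← hl]
    exact congrArg f (Fin.ext (by simp))
  · have h1 : Fin.ofNat (n + 1) k = (⟨k, hk⟩ : Fin n).castSucc :=
      Fin.ext (Nat.mod_eq_of_lt (by omega))
    have h2 : Fin.ofNat (n + 1) (k + 1) = (⟨k, hk⟩ : Fin n).succ :=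
      Fin.ext (Nat.mod_eq_of_lt (by omega))
    simp only [h1, h2]
    exact hf ⟨k, hk⟩

end DiReach

section EarSystem

variable {V : Type*} {G : SimpleGraph V} {S T : Set V} {F F' : V → V → Prop}

/-- The relation `D` restricted to the pairs whose underlying edge is not `e`. -/
def Avoiding (D : V → V → Prop) (e : Sym2 V) (x y : V) : Prop :=
  D x y ∧ s(x, y) ≠ e

theorem Avoiding.mono {D D' : V → V → Prop} (hD : ∀ x y, D x y → D' x y) (e : Sym2 V) (x y : V)
    (h : Avoiding D e x y) : Avoiding D' e x y :=
  ⟨hD x y h.1, h.2⟩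

theorem Avoiding.adj_symm {e : Sym2 V} (x y : V) (h : Avoiding G.Adj e x y) :
    Avoiding G.Adj e y x :=
  ⟨h.1.symm, Sym2.eq_swap ▸ h.2⟩

/-- A walk either avoids a given edge, or has a proper initial segment that avoids the edge and
ends at one of its endpoints. -/
theorem DiReach.avoiding_or {x t s w : V} {n : ℕ} (h : DiReach G.Adj x t n) :
    DiReach (Avoiding G.Adj s(s, w)) x t n ∨
      ∃ m < n, DiReach (Avoiding G.Adj s(s, w)) x s m ∨
        DiReach (Avoiding G.Adj s(s, w)) x w m := by
  induction n generalizing t with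
  | zero => exact Or.inl (h.eq_of_zero ▸ refl _ _)
  | succ n ih =>
    obtain ⟨y, hy, hyt⟩ := h.exists_last
    rcases ih hy with h1 | ⟨m, hm, h1⟩
    · by_cases he : s(y, t) = s(s, w)
      · right
        refine ⟨n, n.lt_succ_self, ?_⟩
        rcases Sym2.eq_iff.1 he with ⟨rfl, rfl⟩ | ⟨rfl, rfl⟩
        · exact Or.inl h1
        · exact Or.inr h1
      · exact Or.inl (h1.snoc ⟨hyt, he⟩)
    · exact Or.inr ⟨m, by omega, h1⟩

/-- `x` lies on a directed ear `s → w → ⋯ → x → ⋯ → t` of `F` with ends in `S` that is no longer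
than any ear of `G` starting with the edge `sw`. -/
def HasShortEar (G : SimpleGraph V) (S : Set V) (F : V → V → Prop) (x : V) : Prop :=
  ∃ s ∈ S, ∃ t ∈ S, ∃ w a b, F s w ∧ DiReach (Avoiding F s(s, w)) w x a ∧
    DiReach (Avoiding F s(s, w)) x t b ∧
    ∀ t' ∈ S, ∀ n, DiReach (Avoiding G.Adj s(s, w)) w t' n → a + b ≤ n

theorem HasShortEar.mono (hF : ∀ x y, F x y → F' x y) {x : V} (h : HasShortEar G S F x) :
    HasShortEar G S F' x := by
  obtain ⟨s, hs, t, ht, w, a, b, hsw, hwx, hxt, hmin⟩ := h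
  exact ⟨s, hs, t, ht, w, a, b, hF _ _ hsw, hwx.mono (Avoiding.mono hF _),
    hxt.mono (Avoiding.mono hF _), hmin⟩

/-- `F` is a partial orientation of `G` on the vertex set `T ⊇ S`, with no arc inside `S`, such
that every vertex of `T` outside `S` lies on a short ear of `F` or of the reverse of `F`. -/
structure IsEarSystem (G : SimpleGraph V) (S : Set V) (F : V → V → Prop) (T : Set V) : Prop where
  subset : S ⊆ T
  adj : ∀ x y, F x y → G.Adj x y
  left_mem : ∀ x y, F x y → x ∈ T
  right_mem : ∀ x y, F x y → y ∈ T
  not_mem : ∀ x y, F x y → ¬ (x ∈ S ∧ y ∈ S)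
  asymm : ∀ x y, F x y → ¬ F y x
  ear : ∀ x ∈ T, x ∉ S → HasShortEar G S F x ∨ HasShortEar G S (flip F) x

namespace IsEarSystem

theorem flip (h : IsEarSystem G S F T) : IsEarSystem G S (flip F) T where
  subset := h.subset
  adj x y hxy := (h.adj y x hxy).symm
  left_mem x y hxy := h.right_mem y x hxy
  right_mem x y hxy := h.left_mem y x hxy
  not_mem x y hxy hS := h.not_mem y x hxy hS.symm
  asymm x y hxy := h.asymm y x hxy
  ear x hx hxS := (h.ear x hx hxS).symm

/-- A short ear through `x` has a half that is no longer than a given walk from `x` to `S`. -/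
theorem exists_short_half (h : IsEarSystem G S F T) {x t : V} {n : ℕ}
    (hx : HasShortEar G S F x) (ht : t ∈ S) (hxt : DiReach G.Adj x t n) :
    ∃ t' ∈ S, ∃ m ≤ n, DiReach F x t' m ∨ DiReach F t' x m := by
  obtain ⟨s, hs, t', ht', w, a, b, hsw, hwx, hxt', hmin⟩ := hx
  have hwx' := hwx.mono (Avoiding.mono h.adj _)
  have hxt'' := hxt'.mono (Avoiding.mono h.adj _)
  have hF : ∀ x y, Avoiding F s(s, w) x y → F x y := fun _ _ hxy => hxy.1
  rcases hxt.avoiding_or (s := s) (w := w) with h1 | ⟨m, hm, h1 | h1⟩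
  · have := hmin t ht _ (hwx'.trans h1)
    exact ⟨t', ht', b, by omega, Or.inl (hxt'.mono hF)⟩
  · have := hmin s hs _ (hwx'.trans h1)
    exact ⟨t', ht', b, by omega, Or.inl (hxt'.mono hF)⟩
  · have := hmin t' ht' _ ((h1.symm Avoiding.adj_symm).trans hxt'')
    exact ⟨s, hs, 1 + a, by omega, Or.inr ((DiReach.single hsw).trans (hwx.mono hF))⟩

theorem exists_short_return (h : IsEarSystem G S F T) {x t : V} {n : ℕ}
    (hx : x ∈ T) (ht : t ∈ S) (hxt : DiReach G.Adj x t n) :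
    ∃ t' ∈ S, ∃ m ≤ n, DiReach F x t' m ∨ DiReach (_root_.flip F) x t' m := by
  by_cases hxS : x ∈ S
  · exact ⟨x, hxS, 0, n.zero_le, Or.inl (DiReach.refl _ _)⟩
  · rcases h.ear x hx hxS with h1 | h1
    · obtain ⟨t', ht', m, hm, h2⟩ := h.exists_short_half h1 ht hxt
      exact ⟨t', ht', m, hm, h2.imp_right DiReach.flip⟩
    · obtain ⟨t', ht', m, hm, h2⟩ := h.flip.exists_short_half h1 ht hxt
      exact ⟨t', ht', m, hm, h2.symm.imp_left DiReach.flip⟩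

/-- An ear system can be enlarged by a path that starts in `S` with an edge leaving `T`, ends at
its first return to `T`, and closes up to a short ear. -/
theorem extend (h : IsEarSystem G S F T) {g : ℕ → V} {i b : ℕ} {t : V} (hi : 2 ≤ i)
    (h0 : g 0 ∈ S) (hiT : g i ∈ T) (hT : ∀ j, 1 ≤ j → j < i → g j ∉ T)
    (hadj : ∀ j < i, G.Adj (g j) (g (j + 1)))
    (havoid : ∀ j, 1 ≤ j → j < i → s(g j, g (j + 1)) ≠ s(g 0, g 1))
    (hinj : ∀ j k, 1 ≤ j → j < i → 1 ≤ k → k < i → g j = g k → j = k)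
    (ht : t ∈ S) (hret : DiReach F (g i) t b)
    (hmin : ∀ t' ∈ S, ∀ n, DiReach (Avoiding G.Adj s(g 0, g 1)) (g 1) t' n → i - 1 + b ≤ n) :
    ∃ F' T', IsEarSystem G S F' T' ∧ T ⊆ T' ∧ g 1 ∈ T' := by
  have hST := h.subset
  set F' : V → V → Prop := fun x y => F x y ∨ ∃ j < i, x = g j ∧ y = g (j + 1)
  have hFF' : ∀ x y, F x y → F' x y := fun x y => Or.inl
  have hnotT : ∀ j < i, ¬ (g j ∈ T ∧ g (j + 1) ∈ T) := by
    rintro j hj ⟨h1, h2⟩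
    rcases Nat.eq_zero_or_pos j with rfl | hj0
    · exact hT 1 le_rfl hi h2
    · exact hT j hj0 hj h1
  have hint : ∀ j k, 1 ≤ j → j < i → 1 ≤ k → k ≤ i → g j = g k → j = k := by
    intro j k hj hji hk hki hjk
    rcases hki.lt_or_eq with hki | rfl
    · exact hinj j k hj hji hk hki hjk
    · exact absurd (hjk ▸ hiT) (hT j hj hji)
  have hstep : ∀ j, 1 ≤ j → j < i → Avoiding F' s(g 0, g 1) (g j) (g (j + 1)) :=
    fun j hj hji => ⟨Or.inr ⟨j, hji, rfl, rfl⟩, havoid j hj hji⟩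
  refine ⟨F', T ∪ {x | ∃ j, 1 ≤ j ∧ j < i ∧ x = g j}, ⟨?_, ?_, ?_, ?_, ?_, ?_, ?_⟩,
    Set.subset_union_left, Or.inr ⟨1, le_rfl, hi, rfl⟩⟩
  · exact hST.trans Set.subset_union_left
  · rintro x y (hxy | ⟨j, hj, rfl, rfl⟩)
    · exact h.adj x y hxy
    · exact hadj j hj
  · rintro x y (hxy | ⟨j, hj, rfl, rfl⟩)
    · exact Or.inl (h.left_mem x y hxy)
    · rcases Nat.eq_zero_or_pos j with rfl | hj0
      · exact Or.inl (hST h0)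
      · exact Or.inr ⟨j, hj0, hj, rfl⟩
  · rintro x y (hxy | ⟨j, hj, rfl, rfl⟩)
    · exact Or.inl (h.right_mem x y hxy)
    · rcases (Nat.succ_le_of_lt hj).lt_or_eq with hj' | hj'
      · exact Or.inr ⟨j + 1, by omega, hj', rfl⟩
      · exact Or.inl (by simpa [← hj'] using hiT)
  · rintro x y (hxy | ⟨j, hj, rfl, rfl⟩) ⟨hx, hy⟩
    · exact h.not_mem x y hxy ⟨hx, hy⟩
    · exact hnotT j hj ⟨hST hx, hST hy⟩
  · rintro x y (hxy | ⟨j, hj, rfl, rfl⟩) (hyx | ⟨k, hk, hyk, hxk⟩)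
    · exact h.asymm x y hxy hyx
    · exact hnotT k hk ⟨hyk ▸ h.right_mem x y hxy, hxk ▸ h.left_mem x y hxy⟩
    · exact hnotT j hj ⟨h.right_mem _ _ hyx, h.left_mem _ _ hyx⟩
    · rcases Nat.eq_zero_or_pos j with rfl | hj0
      · rcases Nat.eq_zero_or_pos k with rfl | hk0
        · exact (hadj 0 hj).ne hyk.symm
        · exact havoid k hk0 hk (by rw [← hyk, ← hxk, Sym2.eq_swap])
      · have hjk := hint j (k + 1) hj0 hj (by omega) hk hxk
        rcases Nat.eq_zero_or_pos k with rfl | hk0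
        · exact havoid j hj0 hj (by rw [hyk, hxk, Sym2.eq_swap])
        · have := hint k (j + 1) hk0 hk (by omega) hj hyk.symm
          omega
  · intro x hx hxS
    by_cases hxT : x ∈ T
    · refine (h.ear x hxT hxS).imp (HasShortEar.mono hFF') (HasShortEar.mono fun x y => hFF' y x)
    · obtain ⟨j, hj, hji, rfl⟩ := hx.resolve_left hxT
      refine Or.inl ⟨g 0, h0, t, ht, g 1, j - 1, i - j + b, Or.inr ⟨0, by omega, rfl, rfl⟩,
        DiReach.of_seq hj fun k hk hkj => hstep k hk (by omega),
        (DiReach.of_seq hji.le fun k hk hki => hstep k (by omega) hki).trans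
          (hret.mono fun x y hxy => ⟨hFF' x y hxy, fun he => ?_⟩), fun t' ht' n hn => ?_⟩
      · rcases Sym2.eq_iff.1 he with ⟨-, rfl⟩ | ⟨rfl, -⟩
        · exact hT 1 le_rfl hi (h.right_mem _ _ hxy)
        · exact hT 1 le_rfl hi (h.left_mem _ _ hxy)
      · have := hmin t' ht' n hn
        omega

/-- An ear system can be enlarged to contain a given neighbour `v` of `S`, provided the edge
joining `v` to `S` lies on an ear. -/
theorem exists_insert (h : IsEarSystem G S F T) {s v t : V} {n : ℕ} (hs : s ∈ S) (hsv : G.Adj s v)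
    (hv : v ∉ T) (ht : t ∈ S) (hvt : DiReach (Avoiding G.Adj s(s, v)) v t n) :
    ∃ F' T', IsEarSystem G S F' T' ∧ T ⊆ T' ∧ v ∈ T' := by
  classical
  have hex : ∃ n, ∃ t ∈ S, DiReach (Avoiding G.Adj s(s, v)) v t n := ⟨n, t, ht, hvt⟩
  obtain ⟨k, ⟨t₀, ht₀, hk⟩, hkmin⟩ : ∃ k, (∃ t ∈ S, DiReach (Avoiding G.Adj s(s, v)) v t k) ∧
      ∀ t' ∈ S, ∀ n, DiReach (Avoiding G.Adj s(s, v)) v t' n → k ≤ n :=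
    ⟨Nat.find hex, Nat.find_spec hex, fun t' ht' n hn => Nat.find_min' hex ⟨t', ht', hn⟩⟩
  obtain ⟨f, hf0, hfk, hf⟩ := hk.exists_seq
  have hfinj : ∀ a b, a < b → b ≤ k → f a ≠ f b := by
    intro a b hab hbk he
    have h1 := DiReach.of_seq (g := f) a.zero_le fun c _ hc => hf c (by omega)
    have h2 := DiReach.of_seq (g := f) hbk fun c _ hc => hf c hc
    rw [hf0] at h1
    rw [hfk, ← he] at h2
    have := hkmin t₀ ht₀ _ (h1.trans h2)
    omega
  have hexT : ∃ i, f i ∈ T := ⟨k, hfk ▸ h.subset ht₀⟩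
  obtain ⟨i, hiT, himin⟩ : ∃ i, f i ∈ T ∧ ∀ j < i, f j ∉ T :=
    ⟨Nat.find hexT, Nat.find_spec hexT, fun j hj => Nat.find_min hexT hj⟩
  have hik : i ≤ k := by
    by_contra! hki
    exact himin k hki (hfk ▸ h.subset ht₀)
  have hi0 : 1 ≤ i := by
    rcases Nat.eq_zero_or_pos i with rfl | hi0
    · exact absurd (hf0 ▸ hiT) hv
    · exact hi0
  have htail := DiReach.of_seq (D := G.Adj) (g := f) hik fun c _ hc => (hf c hc).1
  rw [hfk] at htail
  obtain ⟨g, hg0, hg⟩ : ∃ g : ℕ → V, g 0 = s ∧ ∀ j, g (j + 1) = f j :=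
    ⟨fun j => Nat.casesOn j s f, rfl, fun _ => rfl⟩
  have hg1 : g 1 = v := (hg 0).trans hf0
  obtain ⟨t', ht', m, hm, hret⟩ := h.exists_short_return hiT ht₀ htail
  rw [← hg1]
  have key : ∀ F₀, IsEarSystem G S F₀ T → DiReach F₀ (f i) t' m →
      ∃ F' T', IsEarSystem G S F' T' ∧ T ⊆ T' ∧ g 1 ∈ T' := by
    intro F₀ hF₀ hret
    refine hF₀.extend (i := i + 1) (b := m) (t := t') (by omega) (hg0 ▸ hs) (hg i ▸ hiT)
      ?_ ?_ ?_ ?_ ht' (hg i ▸ hret) ?_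
    · rintro (_ | j) hj hji
      · omega
      · exact hg j ▸ himin j (by omega)
    · rintro (_ | j) hj
      · rw [hg0, zero_add, hg1]
        exact hsv
      · rw [hg, hg]
        exact (hf j (by omega)).1
    · rintro (_ | j) hj hji
      · omega
      · rw [hg, hg, hg0, hg1]
        exact (hf j (by omega)).2
    · rintro (_ | a) (_ | b) ha hai hb hbi hab
      · rfl
      · omega
      · omega
      · rw [hg, hg] at hab
        rcases lt_trichotomy a b with hlt | rfl | hlt
        · exact absurd hab (hfinj a b hlt (by omega))
        · rfl
        · exact absurd hab.symm (hfinj b a hlt (by omega))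
    · rw [hg0, hg1]
      intro t'' ht'' n hn
      have := hkmin t'' ht'' n hn
      omega
  exact hret.elim (key F h) (key _ h.flip)

end IsEarSystem

/-- If every vertex is within distance `r` of `S`, then every edge leaving `S` extends to an ear of
length at most `2 * r + 1`, unless it is a bridge. -/
theorem exists_short_ear {r : ℕ} {s v : V} (hs : s ∈ S) (hv : v ∉ S)
    (hr : ∀ x, ∃ t ∈ S, ∃ n ≤ r, DiReach G.Adj x t n)
    (hsv : ∃ n, DiReach (Avoiding G.Adj s(s, v)) v s n) :
    ∃ t ∈ S, ∃ n ≤ 2 * r, DiReach (Avoiding G.Adj s(s, v)) v t n := by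
  by_contra! hcon
  have hr0 : 0 < r := by
    obtain ⟨t, ht, n, hn, hvt⟩ := hr v
    rcases Nat.eq_zero_or_pos n with rfl | hn0
    · exact absurd (hvt.eq_of_zero ▸ ht) hv
    · omega
  have hnear : ∀ n x, DiReach (Avoiding G.Adj s(s, v)) v x n →
      ∃ m < r, DiReach (Avoiding G.Adj s(s, v)) v x m := by
    intro n
    induction n with
    | zero => exact fun x hx => ⟨0, hr0, hx⟩
    | succ n ih =>
      intro x hx
      obtain ⟨y, hy, hyx⟩ := hx.exists_last
      obtain ⟨m, hm, hvy⟩ := ih y hy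
      obtain ⟨t, ht, k, hk, hxt⟩ := hr x
      rcases hxt.avoiding_or (s := s) (w := v) with h1 | ⟨l, hl, h1 | h1⟩
      · exact absurd ((hvy.snoc hyx).trans h1) (hcon t ht _ (by omega))
      · exact absurd ((hvy.snoc hyx).trans h1) (hcon s hs _ (by omega))
      · exact ⟨l, by omega, h1.symm Avoiding.adj_symm⟩
  obtain ⟨n, hn⟩ := hsv
  obtain ⟨m, hm, hvs⟩ := hnear n s hn
  exact hcon s hs m (by omega) hvs

theorem Bridgeless.exists_diReach_avoiding (hG : Bridgeless G) (s v : V) :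
    ∃ n, DiReach (Avoiding G.Adj s(s, v)) v s n := by
  have h := hG.2 s(s, v)
  rw [isBridge_iff, not_not] at h
  obtain ⟨p⟩ := h.symm
  exact ⟨p.length, (DiReach.of_walk p).mono fun x y hxy => by
    simpa [Avoiding, deleteEdges_adj] using hxy⟩

theorem HasShortEar.exists_diReach {r : ℕ} {x : V} (hG : Bridgeless G)
    (hr : ∀ x, ∃ t ∈ S, ∃ n ≤ r, DiReach G.Adj x t n) (h : IsEarSystem G S F T) (hxS : x ∉ S)
    (hx : HasShortEar G S F x) :
    (∃ t ∈ S, ∃ n ≤ 2 * r, DiReach F x t n) ∧ ∃ t ∈ S, ∃ n ≤ 2 * r, DiReach F t x n := by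
  obtain ⟨s, hs, t, ht, w, a, b, hsw, hwx, hxt, hmin⟩ := hx
  have hw : w ∉ S := fun hw => h.not_mem _ _ hsw ⟨hs, hw⟩
  obtain ⟨t', ht', n, hn, hwt'⟩ := exists_short_ear hs hw hr (hG.exists_diReach_avoiding s w)
  have hab := hmin t' ht' n hwt'
  have hb : b ≠ 0 := by
    rintro rfl
    exact hxS (hxt.eq_of_zero ▸ ht)
  exact ⟨⟨t, ht, b, by omega, hxt.mono fun _ _ hxy => hxy.1⟩,
    s, hs, 1 + a, by omega, (DiReach.single hsw).trans (hwx.mono fun _ _ hxy => hxy.1)⟩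

/-- In a bridgeless graph whose vertices are all within distance `r` of `S`, there is a partial
orientation with no arc inside `S` under which all neighbours of `S` have distance at most `2 * r`
to `S` and from `S`. -/
theorem Bridgeless.exists_partial_orientation [Finite V] {r : ℕ} (hG : Bridgeless G)
    (hr : ∀ x, ∃ t ∈ S, ∃ n ≤ r, DiReach G.Adj x t n) :
    ∃ F T, IsEarSystem G S F T ∧ (∀ s ∈ S, ∀ v, G.Adj s v → v ∈ T) ∧
      ∀ x ∈ T, (∃ t ∈ S, ∃ n ≤ 2 * r, DiReach F x t n) ∧
        ∃ t ∈ S, ∃ n ≤ 2 * r, DiReach F t x n := by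
  have hne : {T : Set V | ∃ F, IsEarSystem G S F T}.Nonempty :=
    ⟨S, fun _ _ => False, subset_rfl, fun _ _ => False.elim, fun _ _ => False.elim,
      fun _ _ => False.elim, fun _ _ => False.elim, fun _ _ => False.elim,
      fun x hx hxS => absurd hx hxS⟩
  obtain ⟨T, ⟨F, hF⟩, hmax⟩ := (Set.toFinite _).exists_maximal hne
  refine ⟨F, T, hF, fun s hs v hsv => ?_, fun x hx => ?_⟩
  · by_contra hv
    obtain ⟨n, hn⟩ := hG.exists_diReach_avoiding s v
    obtain ⟨F', T', hF', hTT', hvT'⟩ := hF.exists_insert hs hsv hv hs hn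
    exact hv (hmax ⟨F', hF'⟩ hTT' hvT')
  · by_cases hxS : x ∈ S
    · exact ⟨⟨x, hxS, 0, Nat.zero_le _, DiReach.refl _ _⟩, x, hxS, 0, Nat.zero_le _,
        DiReach.refl _ _⟩
    · rcases hF.ear x hx hxS with h1 | h1
      · exact h1.exists_diReach hG hr hF hxS
      · obtain ⟨⟨t, ht, n, hn, h2⟩, t', ht', n', hn', h3⟩ := h1.exists_diReach hG hr hF.flip hxS
        exact ⟨⟨t', ht', n', hn', h3.flip⟩, t, ht, n, hn, h2.flip⟩

end EarSystem

/-- Every asymmetric relation along the edges of a graph extends to an orientation. -/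
theorem exists_isOrientation_extending {V : Type*} (G : SimpleGraph V) {D₀ : V → V → Prop}
    (hadj : ∀ x y, D₀ x y → G.Adj x y) (hasymm : ∀ x y, D₀ x y → ¬ D₀ y x) :
    ∃ D, IsOrientation G D ∧ ∀ x y, D₀ x y → D x y := by
  classical
  let D : V → V → Prop := fun x y =>
    D₀ x y ∨ G.Adj x y ∧ ¬ D₀ y x ∧ WellOrderingRel x y
  refine ⟨D, ⟨?_, fun x y hxy => ⟨?_, fun hyx => ?_⟩⟩, fun x y => Or.inl⟩
  · rintro x y (h | h)
    · exact hadj x y h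
    · exact h.1
  · rintro (h | h) (h' | h')
    · exact hasymm x y h h'
    · exact h'.2.1 h
    · exact h.2.1 h'
    · exact _root_.asymm h.2.2 h'.2.2
  · by_contra hD
    have h1 : ¬ D₀ x y := fun h => hD (Or.inl h)
    have h2 : ¬ D₀ y x := fun h => hyx (Or.inl h)
    rcases trichotomous_of (WellOrderingRel (α := V)) x y with h | h | h
    · exact hD (Or.inr ⟨hxy, h2, h⟩)
    · exact hxy.ne h
    · exact hyx (Or.inr ⟨hxy.symm, h1, h⟩)

/-- Let `G` be a bridgeless graph and `H` a bridgeless subgraph of `G` with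
every vertex of `G` at distance at most `2` from `V(H)`. If `H` has a strong orientation of
diameter `d`, then `G` has a strong orientation of diameter at most `d + 12` extending the
given orientation of `H`. -/
theorem orientation_extension_of_dist_le_two
    {V : Type*} [Fintype V] (G : SimpleGraph V)
    (hG : Bridgeless G) (H : G.Subgraph) (hH : Bridgeless H.coe)
    (hdist : ∀ v : V, ∃ u ∈ H.verts, G.dist v u ≤ 2)
    (d : ℕ) (DH : ↥H.verts → ↥H.verts → Prop)
    (hDH : IsOrientation H.coe DH)
    (hDHd : ∀ u v : ↥H.verts, ∃ m ≤ d, DiReach DH u v m) :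
    ∃ D : V → V → Prop, IsOrientation G D ∧
      (∀ u v : V, ∃ m ≤ d + 12, DiReach D u v m) ∧
      ∀ (u v : V) (hu : u ∈ H.verts) (hv : v ∈ H.verts),
        H.Adj u v → (DH ⟨u, hu⟩ ⟨v, hv⟩ ↔ D u v) := by
  have hr : ∀ x, ∃ t ∈ H.verts, ∃ n ≤ 2, DiReach G.Adj x t n := by
    intro x
    obtain ⟨t, ht, hxt⟩ := hdist x
    obtain ⟨p, hp⟩ := hG.1.exists_walk_length_eq_dist x t
    exact ⟨t, ht, p.length, hp ▸ hxt, DiReach.of_walk p⟩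
  obtain ⟨F, T, hF, hnbr, hreach⟩ := hG.exists_partial_orientation hr
  have hr' : ∀ x, ∃ t ∈ T, ∃ n ≤ 1, DiReach G.Adj x t n := by
    intro x
    obtain ⟨t, ht, n, hn, hxt⟩ := hr x
    rcases n with _ | n
    · exact ⟨t, hF.subset ht, 0, zero_le_one, hxt⟩
    · obtain ⟨y, hy, hyt⟩ := hxt.exists_last
      exact ⟨y, hnbr t ht y hyt.symm, n, by omega, hy⟩
  obtain ⟨F', T', hF', hnbr', hreach'⟩ := hG.exists_partial_orientation hr'
  have hT' : ∀ x, x ∈ T' := by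
    intro x
    obtain ⟨t, ht, n, hn, hxt⟩ := hr' x
    rcases n with _ | n
    · exact hF'.subset (hxt.eq_of_zero ▸ ht)
    · obtain rfl : n = 0 := by omega
      obtain ⟨y, hy, hyt⟩ := hxt.exists_last
      exact hnbr' t ht x (hy.eq_of_zero ▸ hyt.symm)
  let E : V → V → Prop := fun x y => ∃ (hx : x ∈ H.verts) (hy : y ∈ H.verts), DH ⟨x, hx⟩ ⟨y, hy⟩
  have hET : ∀ x y, E x y → x ∈ T ∧ y ∈ T := fun x y ⟨hx, hy, _⟩ => ⟨hF.subset hx, hF.subset hy⟩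
  have hFT : ∀ x y, F x y → x ∈ T ∧ y ∈ T :=
    fun x y h => ⟨hF.left_mem x y h, hF.right_mem x y h⟩
  have hEF : ∀ x y, E x y → ¬ F x y ∧ ¬ F y x :=
    fun x y ⟨hx, hy, _⟩ => ⟨fun h => hF.not_mem x y h ⟨hx, hy⟩, fun h => hF.not_mem y x h ⟨hy, hx⟩⟩
  have hadj : ∀ x y, E x y ∨ F x y ∨ F' x y → G.Adj x y := by
    rintro x y (⟨hx, hy, h⟩ | h | h)
    · exact H.adj_sub (hDH.1 _ _ h)
    · exact hF.adj x y h
    · exact hF'.adj x y h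
  have hasymm : ∀ x y, E x y ∨ F x y ∨ F' x y → ¬ (E y x ∨ F y x ∨ F' y x) := by
    rintro x y (h | h | h) (h' | h' | h')
    · obtain ⟨hx, hy, h⟩ := h
      obtain ⟨_, _, h'⟩ := h'
      exact (hDH.2 _ _ (hDH.1 _ _ h)).1 h h'
    · exact (hEF x y h).2 h'
    · exact hF'.not_mem y x h' (hET x y h).symm
    · exact (hEF y x h').2 h
    · exact hF.asymm x y h h'
    · exact hF'.not_mem y x h' (hFT x y h).symm
    · exact hF'.not_mem x y h (hET y x h').symm
    · exact hF'.not_mem x y h (hFT y x h').symm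
    · exact hF'.asymm x y h h'
  obtain ⟨D, hD, hDext⟩ := exists_isOrientation_extending G hadj hasymm
  have hED : ∀ x y, E x y → D x y := fun x y h => hDext x y (Or.inl h)
  have hFD : ∀ x y, F x y → D x y := fun x y h => hDext x y (Or.inr (Or.inl h))
  have hFD' : ∀ x y, F' x y → D x y := fun x y h => hDext x y (Or.inr (Or.inr h))
  refine ⟨D, hD, fun u v => ?_, fun u v hu hv huv => ⟨fun h => hED u v ⟨hu, hv, h⟩, fun h => ?_⟩⟩
  · obtain ⟨⟨u₁, hu₁, a, ha, hua⟩, -⟩ := hreach' u (hT' u)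
    obtain ⟨⟨u₂, hu₂, b, hb, hub⟩, -⟩ := hreach u₁ hu₁
    obtain ⟨-, v₁, hv₁, a', ha', hva⟩ := hreach' v (hT' v)
    obtain ⟨-, v₂, hv₂, b', hb', hvb⟩ := hreach v₁ hv₁
    obtain ⟨m, hm, huv⟩ := hDHd ⟨u₂, hu₂⟩ ⟨v₂, hv₂⟩
    have huv' : DiReach D u₂ v₂ m :=
      huv.map Subtype.val fun x y hxy => hED _ _ ⟨x.2, y.2, hxy⟩
    exact ⟨_, by omega, ((((hua.mono hFD').trans (hub.mono hFD)).trans huv').trans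
      (hvb.mono hFD)).trans (hva.mono hFD')⟩
  · rw [hDH.2 ⟨u, hu⟩ ⟨v, hv⟩ huv]
    exact fun h' => (hD.2 u v (H.adj_sub huv)).1 h (hED v u ⟨hv, hu, h'⟩)
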